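/- Let R be a commutative ring with identity. The set of sequences (x_n)_{n≥1} in R with componentwise addition and multiplication (x·y)_n = ∑_{lcm(i,j)=n} x_i·y_j is a commutative ring Ap(R), and the map φ : Ap(R) → R^{ℕ≥1} defined by φ(x)_n = ∑_{d|n} x_d is a ring isomorphism onto the product ring R^{ℕ≥1} with componentwise operations. -/

import Mathlib

open Finset

/-- The finite set of ordered pairs `(i, j)` of positive integers with `lcm i j = n`. -/
def lcmPairs (n : ℕ) : Finset (ℕ × ℕ) :=
  (n.divisors ×ˢ n.divisors).filter fun p => Nat.lcm p.1 p.2 = n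

/-- Extend a sequence indexed by positive integers to all of `ℕ` by `0`. -/
def seqExt {R : Type*} [Zero R] (x : ℕ+ → R) : ℕ → R :=
  fun n => if h : 0 < n then x ⟨n, h⟩ else 0

theorem seqExt_coe {R : Type*} [Zero R] (x : ℕ+ → R) (n : ℕ+) : seqExt x n = x n :=
  dif_pos n.pos

theorem seqExt_of_pos {R : Type*} [Zero R] (x : ℕ+ → R) {n : ℕ} (hn : 0 < n) :
    seqExt x n = x ⟨n, hn⟩ :=
  dif_pos hn

theorem seqExt_add {R : Type*} [AddZeroClass R] (x y : ℕ+ → R) (n : ℕ) :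
    seqExt (x + y) n = seqExt x n + seqExt y n := by
  by_cases h : 0 < n
  · simp only [seqExt_of_pos _ h]
    rfl
  · simp [seqExt, h]

/-- The divisor sum `φ(x)_n = ∑_{d ∣ n} x_d` of a sequence, as an equivalence whose inverse is
Möbius inversion. -/
def divisorSumEquiv (R : Type*) [Ring R] : (ℕ+ → R) ≃ (ℕ+ → R) where
  toFun x n := ∑ d ∈ (n : ℕ).divisors, seqExt x d
  invFun y n := ∑ p ∈ (n : ℕ).divisorsAntidiagonal,
    (ArithmeticFunction.moebius p.1 : R) * seqExt y p.2
  left_inv x := by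
    funext n
    have h := ArithmeticFunction.sum_eq_iff_sum_mul_moebius_eq (f := seqExt x)
      (g := seqExt fun n : ℕ+ => ∑ d ∈ (n : ℕ).divisors, seqExt x d)
    rw [← seqExt_coe x n]
    exact h.1 (fun m hm => by rw [seqExt_of_pos _ hm, PNat.mk_coe]) n n.pos
  right_inv y := by
    funext n
    have h := ArithmeticFunction.sum_eq_iff_sum_mul_moebius_eq (g := seqExt y)
      (f := seqExt fun n : ℕ+ => ∑ p ∈ (n : ℕ).divisorsAntidiagonal,
        (ArithmeticFunction.moebius p.1 : R) * seqExt y p.2)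
    rw [← seqExt_coe y n]
    exact h.2 (fun m hm => by rw [seqExt_of_pos _ hm, PNat.mk_coe]) n n.pos

theorem divisorSumEquiv_apply {R : Type*} [Ring R] (x : ℕ+ → R) (n : ℕ+) :
    divisorSumEquiv R x n = ∑ d ∈ (n : ℕ).divisors, seqExt x d :=
  rfl

theorem divisorSumEquiv_add {R : Type*} [Ring R] (x y : ℕ+ → R) :
    divisorSumEquiv R (x + y) = divisorSumEquiv R x + divisorSumEquiv R y := by
  funext n
  simp only [divisorSumEquiv_apply, Pi.add_apply, seqExt_add, sum_add_distrib]

theorem sum_divisors_sum_lcmPairs {M : Type*} [AddCommMonoid M] {n : ℕ} (hn : n ≠ 0)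
    (f : ℕ × ℕ → M) :
    ∑ d ∈ n.divisors, ∑ p ∈ lcmPairs d, f p = ∑ p ∈ n.divisors ×ˢ n.divisors, f p := by
  have maps_to : ∀ p ∈ n.divisors ×ˢ n.divisors, Nat.lcm p.1 p.2 ∈ n.divisors := by
    simp only [mem_product, Nat.mem_divisors]
    exact fun p hp => ⟨Nat.lcm_dvd hp.1.1 hp.2.1, hn⟩
  rw [← sum_fiberwise_of_maps_to maps_to]
  refine sum_congr rfl fun d hd => sum_congr ?_ fun _ _ => rfl
  have hdn := Nat.dvd_of_mem_divisors hd
  have hd0 := (Nat.pos_of_mem_divisors hd).ne'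
  ext ⟨i, j⟩
  simp only [lcmPairs, mem_filter, mem_product, Nat.mem_divisors]
  constructor
  · rintro ⟨⟨⟨hi, -⟩, hj, -⟩, h⟩
    exact ⟨⟨⟨hi.trans hdn, hn⟩, hj.trans hdn, hn⟩, h⟩
  · rintro ⟨-, h⟩
    exact ⟨⟨⟨h ▸ Nat.dvd_lcm_left i j, hd0⟩, h ▸ Nat.dvd_lcm_right i j, hd0⟩, h⟩

theorem divisorSumEquiv_lcmConv {R : Type*} [Ring R] (x y : ℕ+ → R) :
    divisorSumEquiv R (fun n => ∑ p ∈ lcmPairs (n : ℕ), seqExt x p.1 * seqExt y p.2) =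
      divisorSumEquiv R x * divisorSumEquiv R y := by
  funext n
  simp only [divisorSumEquiv_apply, Pi.mul_apply]
  rw [sum_mul_sum, ← sum_product',
    ← sum_divisors_sum_lcmPairs n.ne_zero fun p => seqExt x p.1 * seqExt y p.2]
  exact sum_congr rfl fun d hd => seqExt_of_pos _ (Nat.pos_of_mem_divisors hd)

/-- The aperiodic ring `Ap(R)`: the sequences `(x_n)_{n ≥ 1}` with componentwise addition
and multiplication `(x·y)_n = ∑_{lcm(i,j)=n} x_i·y_j` form a commutative ring, and the map
`φ(x)_n = ∑_{d|n} x_d` is a ring isomorphism onto the product ring `R^{ℕ≥1}` with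
componentwise operations. -/
theorem aperiodic_ring_exists (R : Type*) [CommRing R] :
    ∃ inst : CommRing (ℕ+ → R),
      (∀ x y : ℕ+ → R, ∀ n : ℕ+, inst.add x y n = x n + y n) ∧
      (∀ x y : ℕ+ → R, ∀ n : ℕ+, inst.mul x y n =
        ∑ p ∈ lcmPairs (n : ℕ), seqExt x p.1 * seqExt y p.2) ∧
      ∃ e : (ℕ+ → R) ≃ (ℕ+ → R),
        (∀ x : ℕ+ → R, ∀ n : ℕ+, e x n = ∑ d ∈ (n : ℕ).divisors, seqExt x d) ∧
        (∀ x y : ℕ+ → R, e (inst.mul x y) = e x * e y) ∧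
        (∀ x y : ℕ+ → R, e (inst.add x y) = e x + e y) := by
  refine ⟨(divisorSumEquiv R).commRing, fun x y n => ?_, fun x y n => ?_, divisorSumEquiv R,
    divisorSumEquiv_apply, fun x y => ?_, fun x y => ?_⟩
  · change (divisorSumEquiv R).symm (divisorSumEquiv R x + divisorSumEquiv R y) n = _
    rw [← divisorSumEquiv_add, Equiv.symm_apply_apply, Pi.add_apply]
  · change (divisorSumEquiv R).symm (divisorSumEquiv R x * divisorSumEquiv R y) n = _
    rw [← divisorSumEquiv_lcmConv, Equiv.symm_apply_apply]
  · exact (divisorSumEquiv R).apply_symm_apply _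
  · exact (divisorSumEquiv R).apply_symm_apply _
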